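/- Let G be a finite simple graph and let Γ be a nonempty subfamily of Ω(G). If ⋃Γ is a critical set, then ⋂Γ is a critical set as well. -/

import Mathlib

/-- `S` is an independent set in `G`: no two of its vertices are adjacent. -/
def IndepSet {V : Type*} (G : SimpleGraph V) (S : Set V) : Prop :=
  ∀ ⦃u⦄, u ∈ S → ∀ ⦃v⦄, v ∈ S → ¬G.Adj u v

/-- The independence number `α(G)`. -/
noncomputable def indNum {V : Type*} (G : SimpleGraph V) : ℕ :=
  sSup {n : ℕ | ∃ S : Set V, IndepSet G S ∧ S.ncard = n}

/-- `Ω(G)`: the family of maximum independent sets of `G`. -/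
def maxIndepFam {V : Type*} (G : SimpleGraph V) : Set (Set V) :=
  {S | IndepSet G S ∧ S.ncard = indNum G}

/-- `N(X)`: the neighborhood of a set of vertices. -/
def nbhd {V : Type*} (G : SimpleGraph V) (X : Set V) : Set V :=
  {v | ∃ x ∈ X, G.Adj v x}

/-- `N[X] = N(X) ∪ X`: the closed neighborhood of a set of vertices. -/
def closedNbhd {V : Type*} (G : SimpleGraph V) (X : Set V) : Set V :=
  nbhd G X ∪ X

/-- The difference `d(X) = |X| - |N(X)|`. -/
noncomputable def diffd {V : Type*} (G : SimpleGraph V) (X : Set V) : ℤ :=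
  (X.ncard : ℤ) - ((nbhd G X).ncard : ℤ)

/-- The critical difference `d(G) = max {d(X) : X ⊆ V(G)}`. -/
noncomputable def critDiff {V : Type*} (G : SimpleGraph V) : ℤ :=
  sSup {d : ℤ | ∃ X : Set V, diffd G X = d}

/-- `X` is a critical set if `d(X) = d(G)`. -/
def IsCritical {V : Type*} (G : SimpleGraph V) (X : Set V) : Prop :=
  diffd G X = critDiff G

/-- `MaxCritIndep(G)`: the family of critical independent sets of maximum cardinality. -/
def maxCritIndepFam {V : Type*} (G : SimpleGraph V) : Set (Set V) :=
  {S | IndepSet G S ∧ IsCritical G S ∧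
    ∀ T : Set V, IndepSet G T → IsCritical G T → T.ncard ≤ S.ncard}

/-- The critical independence number `α'(G)`. -/
noncomputable def critIndNum {V : Type*} (G : SimpleGraph V) : ℕ :=
  sSup {n : ℕ | ∃ S : Set V, IndepSet G S ∧ IsCritical G S ∧ S.ncard = n}

/-- `ker(G)`: the intersection of all critical independent sets. -/
def kerSet {V : Type*} (G : SimpleGraph V) : Set V :=
  ⋂₀ {A : Set V | IndepSet G A ∧ IsCritical G A}

/-- `nucleus(G)`: the intersection of all maximum critical independent sets. -/
def nucleus {V : Type*} (G : SimpleGraph V) : Set V :=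
  ⋂₀ maxCritIndepFam G

/-- `diadem(G)`: the union of all maximum critical independent sets. -/
def diadem {V : Type*} (G : SimpleGraph V) : Set V :=
  ⋃₀ maxCritIndepFam G

/-- `core(G)`: the intersection of all maximum independent sets. -/
def coreSet {V : Type*} (G : SimpleGraph V) : Set V :=
  ⋂₀ maxIndepFam G

/-- `corona(G)`: the union of all maximum independent sets. -/
def coronaSet {V : Type*} (G : SimpleGraph V) : Set V :=
  ⋃₀ maxIndepFam G

/-- A matching in `G`: a set of pairwise non-incident edges of `G`. -/
def IsMatchingSet {V : Type*} (G : SimpleGraph V) (M : Set (Sym2 V)) : Prop :=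
  M ⊆ G.edgeSet ∧ M.Pairwise fun e f => ∀ v, v ∈ e → v ∉ f

/-- The matching number `μ(G)`. -/
noncomputable def matchNum {V : Type*} (G : SimpleGraph V) : ℕ :=
  sSup {n : ℕ | ∃ M : Set (Sym2 V), IsMatchingSet G M ∧ M.ncard = n}

/-- `G` is a König-Egerváry graph if `α(G) + μ(G) = |V(G)|`. -/
def IsKonigEgervary {V : Type*} (G : SimpleGraph V) : Prop :=
  indNum G + matchNum G = Nat.card V

/-- `Γ` is a König-Egerváry collection: a family of independent sets with
`|⋂Γ| + |⋃Γ| = 2α(G)`. -/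
def IsKECollection {V : Type*} (G : SimpleGraph V) (Γ : Set (Set V)) : Prop :=
  (∀ S ∈ Γ, IndepSet G S) ∧ (⋂₀ Γ).ncard + (⋃₀ Γ).ncard = 2 * indNum G

theorem diffd_le_critDiff {V : Type*} [Finite V] (G : SimpleGraph V) (X : Set V) :
    diffd G X ≤ critDiff G := by
  refine le_csSup ⟨(Nat.card V : ℤ), ?_⟩ ⟨X, rfl⟩
  rintro _ ⟨Y, rfl⟩
  have := Set.ncard_le_card Y
  unfold diffd
  omega

theorem IndepSet.ncard_le_indNum {V : Type*} [Finite V] {G : SimpleGraph V} {S : Set V}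
    (hS : IndepSet G S) : S.ncard ≤ indNum G := by
  refine le_csSup ⟨Nat.card V, ?_⟩ ⟨S, hS, rfl⟩
  rintro _ ⟨T, -, rfl⟩
  exact Set.ncard_le_card T

/-- A maximum independent set is dominating. -/
theorem mem_nbhd_of_mem_maxIndepFam {V : Type*} [Finite V] {G : SimpleGraph V} {S : Set V}
    (hS : S ∈ maxIndepFam G) {v : V} (hv : v ∉ S) : v ∈ nbhd G S := by
  by_contra h
  have hadj : ∀ x ∈ S, ¬G.Adj v x := fun x hx hvx => h ⟨x, hx, hvx⟩
  have hind : IndepSet G (insert v S) := by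
    rintro x (rfl | hx) y (rfl | hy) hxy
    · exact hxy.ne rfl
    · exact hadj y hy hxy
    · exact hadj x hx hxy.symm
    · exact hS.1 hx hy hxy
  have hle := hind.ncard_le_indNum
  rw [Set.ncard_insert_of_notMem hv, hS.2] at hle
  omega

/-- The non-neighbors of the union of a family of maximum independent sets lie in its
intersection. -/
theorem compl_sInter_subset_nbhd_sUnion {V : Type*} [Finite V] {G : SimpleGraph V}
    {Γ : Set (Set V)} (hΓ : Γ ⊆ maxIndepFam G) : (⋂₀ Γ)ᶜ ⊆ nbhd G (⋃₀ Γ) := by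
  intro v hv
  obtain ⟨S, hS, hvS⟩ : ∃ S ∈ Γ, v ∉ S := by simpa using hv
  obtain ⟨x, hx, hvx⟩ := mem_nbhd_of_mem_maxIndepFam (hΓ hS) hvS
  exact ⟨x, ⟨S, hS, hx⟩, hvx⟩

/-- The intersection of a family of independent sets has no neighbor in its union. -/
theorem nbhd_sInter_subset_compl_sUnion {V : Type*} {G : SimpleGraph V}
    {Γ : Set (Set V)} (hΓ : ∀ S ∈ Γ, IndepSet G S) : nbhd G (⋂₀ Γ) ⊆ (⋃₀ Γ)ᶜ := by
  rintro v ⟨x, hx, hvx⟩ ⟨S, hS, hvS⟩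
  exact hΓ S hS hvS (hx S hS) hvx

/-- If `Γ` is a nonempty subfamily of `Ω(G)` and `⋃Γ` is a critical set,
then `⋂Γ` is a critical set as well. -/
theorem stmt19 {V : Type*} [Fintype V] (G : SimpleGraph V)
    (Γ : Set (Set V)) (hne : Γ.Nonempty) (hΓ : Γ ⊆ maxIndepFam G)
    (hcrit : IsCritical G (⋃₀ Γ)) :
    IsCritical G (⋂₀ Γ) := by
  refine le_antisymm (diffd_le_critDiff G _) ?_
  rw [← hcrit]
  have h₁ := Set.ncard_le_ncard (compl_sInter_subset_nbhd_sUnion hΓ)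
  have h₂ := Set.ncard_le_ncard (nbhd_sInter_subset_compl_sUnion fun S hS => (hΓ hS).1)
  have h₃ := Set.ncard_add_ncard_compl (⋂₀ Γ)
  have h₄ := Set.ncard_add_ncard_compl (⋃₀ Γ)
  unfold diffd
  omega
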